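/- sup{z(1) : z ∈ Z} = √(2 log 2)·∫₀¹ √(â(t)) dt, and the supremum is attained by the function z(t) = ∫₀ᵗ v(s) ds. -/

import Mathlib

open MeasureTheory Set Filter

/-- Riemann integrability of `a` on `[0,1]`, encoded via the Lebesgue criterion:
`a` is bounded on `[0,1]`, almost everywhere continuous on `[0,1]`, and (Lebesgue)
integrable on `[0,1]`. -/
def RiemannIntegrableOn01 (a : ℝ → ℝ) : Prop :=
  IntegrableOn a (Set.Icc 0 1) volume ∧
  (∀ᵐ s ∂(volume.restrict (Set.Icc (0:ℝ) 1)), ContinuousAt a s) ∧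
  ∃ C : ℝ, ∀ s ∈ Set.Icc (0:ℝ) 1, |a s| ≤ C

/-- The energy functional: `Ecost a b t` is `∫₀ᵗ b(s)²/(2a(s)) ds`, valued in `[0,∞]`,
with the conventions `0/0 = 0` and `c/0 = ∞` for `c ≠ 0`.
The condition `E(b,t) ≤ 0` of the paper, i.e. `-(log 2)·t + ∫₀ᵗ b(s)²/(2a(s)) ds ≤ 0`,
then reads `Ecost a b t ≤ ENNReal.ofReal (Real.log 2 * t)`. -/
noncomputable def Ecost (a b : ℝ → ℝ) (t : ℝ) : ENNReal :=
  ∫⁻ s in Set.Ioc (0:ℝ) t,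
    (if a s = 0 then (if b s = 0 then 0 else ⊤) else ENNReal.ofReal (b s ^ 2 / (2 * a s)))

/-- Membership in the class `Z`: `z : [0,1] → ℝ` is absolutely continuous with `z(0) = 0`
(equivalently, `z` is the indefinite integral of an integrable function `b`, which is then
the a.e. derivative `z′` of `z`) and `E(z′, t) ≤ 0` for all `t ∈ [0,1]`. -/
def memZ (a z : ℝ → ℝ) : Prop :=
  ∃ b : ℝ → ℝ, IntegrableOn b (Set.Icc (0:ℝ) 1) volume ∧
    (∀ t ∈ Set.Icc (0:ℝ) 1, z t = ∫ s in (0:ℝ)..t, b s) ∧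
    ∀ t ∈ Set.Icc (0:ℝ) 1, Ecost a b t ≤ ENNReal.ofReal (Real.log 2 * t)

/-- `v(s) = a(s)·√(2 log 2 / â(s))` when `â(s) > 0`, and `v(s) = 0` otherwise. -/
noncomputable def vfun (a ahat : ℝ → ℝ) (s : ℝ) : ℝ :=
  if 0 < ahat s then a s * Real.sqrt (2 * Real.log 2 / ahat s) else 0

/-- Where a continuous function lies strictly below its concave hull, the hull is locally affine,
so its left derivative takes a common value on both sides. -/
lemma exists_leftDeriv_eq_of_lt_concaveHull {A Ahat ahat : ℝ → ℝ}
    (hA : ContinuousOn A (Icc 0 1))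
    (hconc : ConcaveOn ℝ (Icc 0 1) Ahat)
    (hge : ∀ t ∈ Icc (0:ℝ) 1, A t ≤ Ahat t)
    (hleast : ∀ g : ℝ → ℝ, ConcaveOn ℝ (Icc 0 1) g →
      (∀ t ∈ Icc (0:ℝ) 1, A t ≤ g t) → ∀ t ∈ Icc (0:ℝ) 1, Ahat t ≤ g t)
    (hderiv : ∀ t ∈ Ioc (0:ℝ) 1, HasDerivWithinAt Ahat (ahat t) (Iic t) t)
    {τ : ℝ} (hτ : τ ∈ Ioo (0:ℝ) 1) (hlt : A τ < Ahat τ) :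
    ∃ s ∈ Ioo 0 τ, ∃ r ∈ Ioo τ 1, ahat s = ahat r := by
  have hIcc : Icc (0:ℝ) 1 ∈ nhds τ := Icc_mem_nhds hτ.1 hτ.2
  have hcA : ContinuousAt A τ := hA.continuousAt hIcc
  have hcAhat : ContinuousAt Ahat τ :=
    hconc.continuousOn_interior.continuousAt (isOpen_interior.mem_nhds (by simpa using hτ))
  obtain ⟨m, hm1, hm2⟩ := exists_between hlt
  obtain ⟨l, u, hlu, hsub⟩ := mem_nhds_iff_exists_Ioo_subset.1
    (inter_mem (hcA.eventually (gt_mem_nhds hm1)) (hcAhat.eventually (lt_mem_nhds hm2)))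
  obtain ⟨p, hp, hpτ⟩ := exists_between (max_lt hlu.1 hτ.1)
  obtain ⟨q, hτq, hq⟩ := exists_between (lt_min hlu.2 hτ.2)
  obtain ⟨hlp, hp0⟩ := max_lt_iff.1 hp
  obtain ⟨hqu, hq1⟩ := lt_min_iff.1 hq
  have hmem : ∀ s ∈ Icc p q, A s < m ∧ m < Ahat s := fun s hs =>
    hsub ⟨hlp.trans_le hs.1, hs.2.trans_lt hqu⟩
  have hpq : p < q := hpτ.trans hτq
  set k := (Ahat q - Ahat p) / (q - p) with hk
  have hkeq : k * (q - p) = Ahat q - Ahat p := div_mul_cancel₀ _ (by linarith)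
  set L : ℝ → ℝ := fun s => Ahat p + k * (s - p) with hL
  have hp01 : p ∈ Icc (0:ℝ) 1 := ⟨hp0.le, by linarith⟩
  have hq01 : q ∈ Icc (0:ℝ) 1 := ⟨by linarith, hq1.le⟩
  have hLderiv : ∀ s, HasDerivAt L k s := fun s => by
    simpa [hL] using ((hasDerivAt_id' s).sub_const p).const_mul k
  have hLconc : ConcaveOn ℝ (Icc 0 1) L := by
    refine ⟨convex_Icc 0 1, fun x _ y _ c d _ _ hcd => le_of_eq ?_⟩
    simp only [hL, smul_eq_mul]
    linear_combination (Ahat p - k * p) * hcd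
  have hLm : ∀ s ∈ Icc p q, m ≤ L s := by
    intro s hs
    rcases le_total 0 k with h | h
    · have := mul_nonneg h (sub_nonneg.2 hs.1)
      have := (hmem p ⟨le_rfl, hpq.le⟩).2
      simp only [hL]; linarith
    · have := mul_nonneg_of_nonpos_of_nonpos h (sub_nonpos.2 hs.2)
      have := (hmem q ⟨hpq.le, le_rfl⟩).2
      simp only [hL]; linarith
  have hin : ∀ s ∈ Icc p q, L s ≤ Ahat s := by
    intro s hs
    rcases hs.1.eq_or_lt with rfl | h1
    · simp [hL]
    rcases hs.2.eq_or_lt with rfl | h2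
    · simp only [hL]; linarith
    have := hconc.slope_anti_adjacent hp01 hq01 h1 h2
    rw [div_le_div_iff₀ (by linarith) (by linarith)] at this
    have hm : 0 ≤ (Ahat s - L s) * (q - p) := by
      simp only [hL]; linear_combination this + (s - p) * hkeq
    have := nonneg_of_mul_nonneg_left hm (by linarith)
    linarith
  have hout : ∀ s ∈ Icc (0:ℝ) 1, s ∉ Icc p q → Ahat s ≤ L s := by
    intro s hs hn
    rcases lt_or_ge s p with h | h
    · have := hconc.slope_anti_adjacent hs hq01 h hpq
      rw [← hk, le_div_iff₀ (by linarith)] at this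
      simp only [hL]; linarith
    · have h : q < s := by
        by_contra h'
        exact hn ⟨h, not_lt.1 h'⟩
      have := hconc.slope_anti_adjacent hp01 hs hpq h
      rw [← hk, div_le_iff₀ (by linarith)] at this
      simp only [hL]; linarith
  have hle := hleast _ (hconc.inf hLconc) fun t ht => by
    refine le_inf (hge t ht) ?_
    by_cases h : t ∈ Icc p q
    · exact (hmem t h).1.le.trans (hLm t h)
    · exact (hge t ht).trans (hout t ht h)
  have heq : ∀ s ∈ Icc p q, Ahat s = L s := fun s hs =>
    le_antisymm ((hle s ⟨hp01.1.trans hs.1, hs.2.trans hq01.2⟩).trans inf_le_right) (hin s hs)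
  have hval : ∀ s ∈ Ioc p q, ahat s = k := by
    intro s hs
    have h1 := hderiv s ⟨hp0.trans hs.1, hs.2.trans hq1.le⟩
    have hev : L =ᶠ[nhdsWithin s (Iic s)] Ahat := by
      filter_upwards [self_mem_nhdsWithin, mem_nhdsWithin_of_mem_nhds (lt_mem_nhds hs.1)]
        with x hx hx'
      exact (heq x ⟨le_of_lt hx', le_trans hx hs.2⟩).symm
    have h2 := h1.congr_of_eventuallyEq hev (heq s ⟨hs.1.le, hs.2⟩).symm
    exact (uniqueDiffOn_Iic s s (mem_Iic.2 le_rfl)).eq_deriv _ h2 (hLderiv s).hasDerivWithinAt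
  obtain ⟨s, hs1, hs2⟩ := exists_between hpτ
  refine ⟨s, ⟨hp0.trans hs1, hs2⟩, q, ⟨hτq, hq1⟩, ?_⟩
  rw [hval s ⟨hs1, by linarith⟩, hval q ⟨hpq, le_rfl⟩]

/-- The superlevel set of an antitone function on `(0,1]` is an initial interval, up to its
right endpoint. -/
lemma exists_threshold_of_antitoneOn {f : ℝ → ℝ} (hf : AntitoneOn f (Ioc 0 1)) (c : ℝ) :
    ∃ τ ∈ Icc (0:ℝ) 1, (∀ s ∈ Ioo 0 τ, c ≤ f s) ∧ ∀ s ∈ Ioc τ 1, f s < c := by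
  set S : Set ℝ := insert 0 {s ∈ Ioc (0:ℝ) 1 | c ≤ f s}
  have hS : S ⊆ Icc 0 1 := by
    rintro s (rfl | hs)
    · simp
    · exact ⟨hs.1.1.le, hs.1.2⟩
  have hbdd : BddAbove S := ⟨1, fun s hs => (hS hs).2⟩
  have h0 : (0:ℝ) ∈ S := mem_insert _ _
  have hτ0 : 0 ≤ sSup S := le_csSup hbdd h0
  refine ⟨sSup S, ⟨hτ0, csSup_le ⟨0, h0⟩ fun s hs => (hS hs).2⟩, fun s hs => ?_, fun s hs => ?_⟩
  · obtain ⟨r, hr, hsr⟩ := exists_lt_of_lt_csSup ⟨0, h0⟩ hs.2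
    rcases hr with rfl | hr
    · exact absurd hsr hs.1.not_gt
    · exact hr.2.trans (hf ⟨hs.1, hsr.le.trans hr.1.2⟩ hr.1 hsr.le)
  · by_contra! h
    exact (le_csSup hbdd (mem_insert_of_mem _ ⟨⟨hτ0.trans_lt hs.1, hs.2⟩, h⟩)).not_gt hs.1

/-- The fundamental theorem of calculus for a left derivative. -/
lemma integral_eq_sub_of_hasDerivWithinAt_Iic {f f' : ℝ → ℝ} {x y : ℝ} (hxy : x ≤ y)
    (hf : ContinuousOn f (Icc x y))
    (hderiv : ∀ t ∈ Ioo x y, HasDerivWithinAt f (f' t) (Iic t) t)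
    (hint : IntervalIntegrable f' volume x y) :
    ∫ t in x..y, f' t = f y - f x := by
  have hcont : ContinuousOn (fun t => -f (-t)) (Icc (-y) (-x)) :=
    (hf.comp continuousOn_neg fun t ht => ⟨by linarith [ht.2], by linarith [ht.1]⟩).neg
  have key := intervalIntegral.integral_eq_sub_of_hasDeriv_right_of_le (f' := fun t => f' (-t))
    (neg_le_neg hxy) hcont
    (fun t ht => by
      have h1 := hderiv (-t) ⟨by linarith [ht.2], by linarith [ht.1]⟩
      have h2 := (h1.scomp t (hasDerivAt_neg t).hasDerivWithinAt
        (fun s (hs : t < s) => by simpa using hs.le) (s := Ioi t)).neg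
      simpa [Function.comp_def, Pi.neg_def] using h2)
    (by simpa using ((IntervalIntegrable.iff_comp_neg).1 hint).symm)
  rw [intervalIntegral.integral_comp_neg] at key
  simpa [neg_add_eq_sub] using key

/-- `α` relates to `a` as the left derivative of the concave hull relates to the density:
its primitive dominates that of `a` on `[0,1]`, with equality at `1` and at every point which
separates the values of `α`. -/
structure IsHullDensity (a α : ℝ → ℝ) : Prop where
  nonneg_left : ∀ s ∈ Ioc (0:ℝ) 1, 0 ≤ a s
  nonneg_right : ∀ s ∈ Ioc (0:ℝ) 1, 0 ≤ α s
  integrable_left : IntegrableOn a (Ioc 0 1)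
  integrable_right : IntegrableOn α (Ioc 0 1)
  antitone : AntitoneOn α (Ioc 0 1)
  le : ∀ t ∈ Icc (0:ℝ) 1, ∫ s in (0:ℝ)..t, a s ≤ ∫ s in (0:ℝ)..t, α s
  eq_one : ∫ s in (0:ℝ)..1, a s = ∫ s in (0:ℝ)..1, α s
  exists_eq_of_lt : ∀ τ ∈ Ioo (0:ℝ) 1,
    ∫ s in (0:ℝ)..τ, a s < ∫ s in (0:ℝ)..τ, α s → ∃ s ∈ Ioo 0 τ, ∃ r ∈ Ioo τ 1, α s = α r

/-- The measure on `(0,t]` with density `f`. -/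
noncomputable def densityOn (f : ℝ → ℝ) (t : ℝ) : Measure ℝ :=
  (volume.restrict (Ioc 0 t)).withDensity fun s => ENNReal.ofReal (f s)

lemma densityOn_apply (f : ℝ → ℝ) (t : ℝ) (S : Set ℝ) :
    densityOn f t S = ∫⁻ s in S ∩ Ioc 0 t, ENNReal.ofReal (f s) := by
  rw [densityOn, withDensity_apply', Measure.restrict_restrict' measurableSet_Ioc]

lemma setLIntegral_Ioc_ofReal {f : ℝ → ℝ} (hf : ∀ s ∈ Ioc (0:ℝ) 1, 0 ≤ f s)
    (hint : IntegrableOn f (Ioc 0 1)) {x y : ℝ} (hx : 0 ≤ x) (hxy : x ≤ y) (hy : y ≤ 1) :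
    ∫⁻ s in Ioc x y, ENNReal.ofReal (f s) =
      ENNReal.ofReal ((∫ s in (0:ℝ)..y, f s) - ∫ s in (0:ℝ)..x, f s) := by
  have hsub : Ioc x y ⊆ Ioc 0 1 := Ioc_subset_Ioc hx hy
  have hi : ∀ z, 0 ≤ z → z ≤ 1 → IntervalIntegrable f volume 0 z := fun z h0 h1 =>
    (intervalIntegrable_iff_integrableOn_Ioc_of_le h0).2
      (hint.mono_set (Ioc_subset_Ioc le_rfl h1))
  rw [intervalIntegral.integral_interval_sub_left (hi y (hx.trans hxy) hy) (hi x hx (hxy.trans hy)),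
    intervalIntegral.integral_of_le hxy, ofReal_integral_eq_lintegral_ofReal (hint.mono_set hsub)]
  filter_upwards [ae_restrict_mem measurableSet_Ioc] with s hs using hf s (hsub hs)

namespace IsHullDensity

variable {a α : ℝ → ℝ}

lemma exists_sublevel_ae_eq (h : IsHullDensity a α) (c : ℝ) :
    ∃ τ ∈ Icc (0:ℝ) 1, ∫ s in (0:ℝ)..τ, a s = ∫ s in (0:ℝ)..τ, α s ∧
      ∀ t ≤ 1, ({s | α s < c} ∩ Ioc 0 t : Set ℝ) =ᵐ[volume] Ioc τ t := by
  obtain ⟨τ, hτ, hl, hr⟩ := exists_threshold_of_antitoneOn h.antitone c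
  refine ⟨τ, hτ, ?_, fun t ht => ?_⟩
  · rcases hτ.1.eq_or_lt with rfl | h0
    · simp
    rcases hτ.2.eq_or_lt with rfl | h1
    · exact h.eq_one
    refine (h.le τ hτ).eq_or_lt.resolve_right fun hlt => ?_
    obtain ⟨s, hs, r, hr', hsr⟩ := h.exists_eq_of_lt τ ⟨h0, h1⟩ hlt
    exact absurd (hr r ⟨hr'.1, hr'.2.le⟩) (hsr ▸ hl s hs).not_gt
  · have hne : ∀ᵐ s ∂(volume : Measure ℝ), s ≠ τ := by simp [ae_iff]
    filter_upwards [hne] with s hs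
    refine propext ⟨fun ⟨h1, h2⟩ => ⟨?_, h2.2⟩, fun h1 => ⟨?_, hτ.1.trans_lt h1.1, h1.2⟩⟩
    · by_contra! h3
      exact (hl s ⟨h2.1, lt_of_le_of_ne h3 hs⟩).not_gt h1
    · exact hr s ⟨h1.1, h1.2.trans ht⟩

lemma densityOn_sublevel_le (h : IsHullDensity a α) {t : ℝ} (ht : t ∈ Icc (0:ℝ) 1) (c : ℝ) :
    densityOn a t {s | α s < c} ≤ densityOn α t {s | α s < c} := by
  obtain ⟨τ, hτ, heq, hS⟩ := h.exists_sublevel_ae_eq c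
  rw [densityOn_apply, densityOn_apply, setLIntegral_congr (hS t ht.2),
    setLIntegral_congr (hS t ht.2)]
  rcases le_total t τ with hτt | hτt
  · simp [Ioc_eq_empty_of_le hτt]
  · rw [setLIntegral_Ioc_ofReal h.nonneg_left h.integrable_left hτ.1 hτt ht.2,
      setLIntegral_Ioc_ofReal h.nonneg_right h.integrable_right hτ.1 hτt ht.2, heq]
    exact ENNReal.ofReal_le_ofReal (sub_le_sub_right (h.le t ht) _)

lemma densityOn_sublevel_eq (h : IsHullDensity a α) (c : ℝ) :
    densityOn a 1 {s | α s < c} = densityOn α 1 {s | α s < c} := by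
  obtain ⟨τ, hτ, heq, hS⟩ := h.exists_sublevel_ae_eq c
  rw [densityOn_apply, densityOn_apply, setLIntegral_congr (hS 1 le_rfl),
    setLIntegral_congr (hS 1 le_rfl),
    setLIntegral_Ioc_ofReal h.nonneg_left h.integrable_left hτ.1 hτ.2 le_rfl,
    setLIntegral_Ioc_ofReal h.nonneg_right h.integrable_right hτ.1 hτ.2 le_rfl, heq, h.eq_one]

lemma aemeasurable_left (h : IsHullDensity a α) {t : ℝ} (ht : t ≤ 1) :
    AEMeasurable a (volume.restrict (Ioc 0 t)) :=
  h.integrable_left.aemeasurable.mono_measure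
    (Measure.restrict_mono (Ioc_subset_Ioc le_rfl ht) le_rfl)

lemma aemeasurable_right (h : IsHullDensity a α) {t : ℝ} (ht : t ≤ 1) :
    AEMeasurable α (volume.restrict (Ioc 0 t)) :=
  h.integrable_right.aemeasurable.mono_measure
    (Measure.restrict_mono (Ioc_subset_Ioc le_rfl ht) le_rfl)

lemma densityOn_nonpos (h : IsHullDensity a α) {t : ℝ} (ht : t ∈ Icc (0:ℝ) 1) :
    densityOn a t {s | α s ≤ 0} = 0 := by
  by_contra hne
  obtain ⟨c, hc0, hc⟩ := ENNReal.lt_iff_exists_nnreal_btwn.1 (pos_iff_ne_zero.2 hne)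
  refine hc.not_ge ?_
  calc densityOn a t {s | α s ≤ 0} ≤ densityOn a t {s | α s < c} :=
        measure_mono fun s hs => lt_of_le_of_lt (b := (0:ℝ)) hs (by exact_mod_cast hc0)
    _ ≤ densityOn α t {s | α s < c} := h.densityOn_sublevel_le ht c
    _ = ∫⁻ s in Ioc 0 t ∩ {s | α s < c}, ENNReal.ofReal (α s) := by
        rw [densityOn_apply, inter_comm]
    _ ≤ ∫⁻ s in Ioc 0 t ∩ {s | α s < c}, c := by
        obtain ⟨τ, hτ, heq, hS⟩ := h.exists_sublevel_ae_eq c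
        have hnull : NullMeasurableSet (Ioc 0 t ∩ {s | α s < c}) :=
          measurableSet_Ioc.nullMeasurableSet.congr (inter_comm _ _ ▸ hS t ht.2).symm
        refine lintegral_mono_ae ?_
        filter_upwards [ae_restrict_mem₀ hnull] with s hs
        exact ENNReal.ofReal_le_of_le_toReal (le_of_lt hs.2)
    _ ≤ c := by
        rw [setLIntegral_const]
        calc (c : ENNReal) * volume (Ioc 0 t ∩ {s | α s < c}) ≤ c * volume (Ioc (0:ℝ) 1) := by
              gcongr
              exact inter_subset_left.trans (Ioc_subset_Ioc le_rfl ht.2)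
          _ = c := by simp

lemma ae_pos_left (h : IsHullDensity a α) {t : ℝ} (ht : t ∈ Icc (0:ℝ) 1) :
    ∀ᵐ s ∂densityOn a t, 0 < α s := by
  simpa [ae_iff] using h.densityOn_nonpos ht

lemma ae_pos_right (h : IsHullDensity a α) {t : ℝ} (ht : t ≤ 1) :
    ∀ᵐ s ∂densityOn α t, 0 < α s := by
  rw [densityOn, ae_withDensity_iff' (h.aemeasurable_right ht).ennreal_ofReal]
  exact Eventually.of_forall fun s hs => by simpa using hs

end IsHullDensity

/-- Two measures compared on the sublevel sets of `α` compare on decreasing functions of `α`. -/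
lemma lintegral_comp_le_of_sublevel_le {M N : Measure ℝ} {α ψ : ℝ → ℝ}
    (hαM : AEMeasurable α M) (hαN : AEMeasurable α N)
    (hM : ∀ᵐ s ∂M, 0 < α s) (hN : ∀ᵐ s ∂N, 0 < α s)
    (hle : ∀ c, M {s | α s < c} ≤ N {s | α s < c})
    (hψ : Measurable ψ) (hψ0 : ∀ x, 0 ≤ ψ x)
    (hlevel : ∀ y > 0, ∃ c, ∀ x > 0, y < ψ x ↔ x < c) :
    ∫⁻ s, ENNReal.ofReal (ψ (α s)) ∂M ≤ ∫⁻ s, ENNReal.ofReal (ψ (α s)) ∂N := by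
  rw [lintegral_eq_lintegral_meas_lt M (Eventually.of_forall fun s => hψ0 _)
      (hψ.comp_aemeasurable hαM),
    lintegral_eq_lintegral_meas_lt N (Eventually.of_forall fun s => hψ0 _)
      (hψ.comp_aemeasurable hαN)]
  refine setLIntegral_mono' measurableSet_Ioi fun y hy => ?_
  obtain ⟨c, hc⟩ := hlevel y hy
  have hcongr : ∀ P : Measure ℝ, (∀ᵐ s ∂P, 0 < α s) →
      P {s | y < ψ (α s)} = P {s | α s < c} := fun P hP => by
    refine measure_congr ?_
    filter_upwards [hP] with s hs using propext (hc _ hs)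
  exact (hcongr M hM).le.trans ((hle c).trans (hcongr N hN).ge)

/-- Abel summation: densities compared on all initial intervals compare against nonnegative
antitone weights. -/
lemma lintegral_mul_ofReal_le_of_antitoneOn {f g : ℝ → ENNReal} {ψ : ℝ → ℝ}
    (hf : AEMeasurable f (volume.restrict (Ioc 0 1)))
    (hg : AEMeasurable g (volume.restrict (Ioc 0 1)))
    (hle : ∀ t ∈ Icc (0:ℝ) 1, ∫⁻ s in Ioc 0 t, f s ≤ ∫⁻ s in Ioc 0 t, g s)
    (hψ : AntitoneOn ψ (Ioc 0 1)) (hψ0 : ∀ s, 0 ≤ ψ s) :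
    ∫⁻ s in Ioc 0 1, f s * ENNReal.ofReal (ψ s) ≤
      ∫⁻ s in Ioc 0 1, g s * ENNReal.ofReal (ψ s) := by
  have hmeas : AEMeasurable ψ (volume.restrict (Ioc 0 1)) :=
    aemeasurable_restrict_of_antitoneOn measurableSet_Ioc hψ
  have hlayer : ∀ k : ℝ → ENNReal, AEMeasurable k (volume.restrict (Ioc 0 1)) →
      ∫⁻ s in Ioc 0 1, k s * ENNReal.ofReal (ψ s) =
        ∫⁻ y in Ioi 0, ∫⁻ s in {s | y ≤ ψ s} ∩ Ioc 0 1, k s := fun k hk => by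
    have h1 := lintegral_withDensity_eq_lintegral_mul₀ hk hmeas.ennreal_ofReal
    simp only [Pi.mul_apply] at h1
    rw [← h1, lintegral_eq_lintegral_meas_le _ (Eventually.of_forall hψ0)
      (hmeas.mono_ac (withDensity_absolutelyContinuous _ _))]
    simp_rw [withDensity_apply', Measure.restrict_restrict' measurableSet_Ioc]
  rw [hlayer f hf, hlayer g hg]
  refine lintegral_mono fun y => ?_
  obtain ⟨τ, hτ, hl, hr⟩ := exists_threshold_of_antitoneOn hψ y
  have hS : ({s | y ≤ ψ s} ∩ Ioc 0 1 : Set ℝ) =ᵐ[volume] Ioc 0 τ := by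
    have hne : ∀ᵐ s ∂(volume : Measure ℝ), s ≠ τ := by simp [ae_iff]
    filter_upwards [hne] with s hs
    refine propext ⟨fun ⟨h1, h2⟩ => ⟨h2.1, ?_⟩, fun h1 => ⟨?_, h1.1, h1.2.trans hτ.2⟩⟩
    · by_contra! h3
      exact (hr s ⟨h3, h2.2⟩).not_ge h1
    · exact hl s ⟨h1.1, lt_of_le_of_ne h1.2 hs⟩
  rw [setLIntegral_congr hS, setLIntegral_congr hS]
  exact hle τ hτ

namespace IsHullDensity

variable {a α : ℝ → ℝ}

lemma lintegral_densityOn_left (h : IsHullDensity a α) {t : ℝ} (ht : t ≤ 1) {ψ : ℝ → ℝ}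
    (hψ : Measurable ψ) :
    ∫⁻ s, ENNReal.ofReal (ψ (α s)) ∂densityOn a t =
      ∫⁻ s in Ioc 0 t, ENNReal.ofReal (a s) * ENNReal.ofReal (ψ (α s)) :=
  lintegral_withDensity_eq_lintegral_mul₀ (h.aemeasurable_left ht).ennreal_ofReal
    (hψ.comp_aemeasurable (h.aemeasurable_right ht)).ennreal_ofReal

lemma lintegral_densityOn_right (h : IsHullDensity a α) {t : ℝ} (ht : t ≤ 1) {ψ : ℝ → ℝ}
    (hψ : Measurable ψ) :
    ∫⁻ s, ENNReal.ofReal (ψ (α s)) ∂densityOn α t =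
      ∫⁻ s in Ioc 0 t, ENNReal.ofReal (α s) * ENNReal.ofReal (ψ (α s)) :=
  lintegral_withDensity_eq_lintegral_mul₀ (h.aemeasurable_right ht).ennreal_ofReal
    (hψ.comp_aemeasurable (h.aemeasurable_right ht)).ennreal_ofReal

lemma aemeasurable_densityOn_left (h : IsHullDensity a α) {t : ℝ} (ht : t ≤ 1) :
    AEMeasurable α (densityOn a t) :=
  (h.aemeasurable_right ht).mono_ac (withDensity_absolutelyContinuous _ _)

lemma aemeasurable_densityOn_right (h : IsHullDensity a α) {t : ℝ} (ht : t ≤ 1) :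
    AEMeasurable α (densityOn α t) :=
  (h.aemeasurable_right ht).mono_ac (withDensity_absolutelyContinuous _ _)

lemma ae_pos_of_pos (h : IsHullDensity a α) :
    ∀ᵐ s ∂volume.restrict (Ioc (0:ℝ) 1), 0 < a s → 0 < α s := by
  have := h.ae_pos_left (t := 1) (by simp)
  rw [densityOn, ae_withDensity_iff' (h.aemeasurable_left le_rfl).ennreal_ofReal] at this
  simpa using this

lemma lintegral_mul_inv_le (h : IsHullDensity a α) {t : ℝ} (ht : t ∈ Icc (0:ℝ) 1) :
    ∫⁻ s in Ioc 0 t, ENNReal.ofReal (a s) * ENNReal.ofReal (α s)⁻¹ ≤ ENNReal.ofReal t := by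
  have hψ : Measurable fun x : ℝ => (max x 0)⁻¹ := (measurable_id.max measurable_const).inv
  have hα : ∀ s ∈ Ioc 0 t, max (α s) 0 = α s := fun s hs =>
    max_eq_left (h.nonneg_right s ⟨hs.1, hs.2.trans ht.2⟩)
  have key := lintegral_comp_le_of_sublevel_le (h.aemeasurable_densityOn_left ht.2)
    (h.aemeasurable_densityOn_right ht.2) (h.ae_pos_left ht) (h.ae_pos_right ht.2)
    (h.densityOn_sublevel_le ht) hψ (fun x => by positivity) fun y hy =>
      ⟨y⁻¹, fun x hx => by rw [max_eq_left hx.le, lt_inv_comm₀ hy hx]⟩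
  rw [h.lintegral_densityOn_left ht.2 hψ, h.lintegral_densityOn_right ht.2 hψ] at key
  calc _ = ∫⁻ s in Ioc 0 t, ENNReal.ofReal (a s) * ENNReal.ofReal (max (α s) 0)⁻¹ :=
        setLIntegral_congr_fun measurableSet_Ioc fun s hs => by simp only [hα s hs]
    _ ≤ _ := key
    _ ≤ ∫⁻ s in Ioc 0 t, 1 := setLIntegral_mono' measurableSet_Ioc fun s hs => by
        have h0 := h.nonneg_right s ⟨hs.1, hs.2.trans ht.2⟩
        rw [hα s hs, ← ENNReal.ofReal_mul h0, ← ENNReal.ofReal_one]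
        exact ENNReal.ofReal_le_ofReal mul_inv_le_one
    _ = ENNReal.ofReal t := by simp

lemma lintegral_mul_inv_sqrt (h : IsHullDensity a α) :
    ∫⁻ s in Ioc 0 1, ENNReal.ofReal (a s) * ENNReal.ofReal (√(α s))⁻¹ =
      ∫⁻ s in Ioc 0 1, ENNReal.ofReal √(α s) := by
  have hψ : Measurable fun x : ℝ => (√x)⁻¹ := Real.continuous_sqrt.measurable.inv
  have hlevel : ∀ y > (0:ℝ), ∃ c, ∀ x > 0, y < (√x)⁻¹ ↔ x < c := fun y hy =>
    ⟨y⁻¹ ^ 2, fun x hx => by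
      rw [lt_inv_comm₀ hy (Real.sqrt_pos.2 hx), Real.sqrt_lt' (inv_pos.2 hy)]⟩
  have h1 : (1:ℝ) ∈ Icc (0:ℝ) 1 := by simp
  have key := le_antisymm
    (lintegral_comp_le_of_sublevel_le (h.aemeasurable_densityOn_left le_rfl)
      (h.aemeasurable_densityOn_right le_rfl) (h.ae_pos_left h1) (h.ae_pos_right le_rfl)
      (fun c => (h.densityOn_sublevel_eq c).le) hψ (fun x => by positivity) hlevel)
    (lintegral_comp_le_of_sublevel_le (α := α) (h.aemeasurable_densityOn_right le_rfl)
      (h.aemeasurable_densityOn_left le_rfl) (h.ae_pos_right le_rfl) (h.ae_pos_left h1)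
      (fun c => (h.densityOn_sublevel_eq c).ge) hψ (fun x => by positivity) hlevel)
  rw [h.lintegral_densityOn_left le_rfl hψ, h.lintegral_densityOn_right le_rfl hψ] at key
  rw [key]
  refine setLIntegral_congr_fun measurableSet_Ioc fun s hs => ?_
  rw [← ENNReal.ofReal_mul (h.nonneg_right s hs), ← div_eq_mul_inv, Real.div_sqrt]

end IsHullDensity

/-- The left derivative of the concave hull of a distribution function with bounded density `a`
satisfies `IsHullDensity a`. -/
lemma isHullDensity_of_concaveHull {a A Ahat ahat : ℝ → ℝ} {C : ℝ}
    (ha_nonneg : ∀ s ∈ Icc (0:ℝ) 1, 0 ≤ a s)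
    (ha_int : IntegrableOn a (Icc 0 1))
    (hC : ∀ s ∈ Icc (0:ℝ) 1, |a s| ≤ C)
    (hA : ∀ t ∈ Icc (0:ℝ) 1, A t = ∫ s in (0:ℝ)..t, a s)
    (hconc : ConcaveOn ℝ (Icc 0 1) Ahat)
    (hge : ∀ t ∈ Icc (0:ℝ) 1, A t ≤ Ahat t)
    (hleast : ∀ g : ℝ → ℝ, ConcaveOn ℝ (Icc 0 1) g →
      (∀ t ∈ Icc (0:ℝ) 1, A t ≤ g t) → ∀ t ∈ Icc (0:ℝ) 1, Ahat t ≤ g t)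
    (hderiv : ∀ t ∈ Ioc (0:ℝ) 1, HasDerivWithinAt Ahat (ahat t) (Iic t) t)
    (hnonneg : ∀ t ∈ Ioc (0:ℝ) 1, 0 ≤ ahat t)
    (hanti : AntitoneOn ahat (Ioc 0 1)) :
    IsHullDensity a ahat := by
  have h0 : (0:ℝ) ∈ Icc (0:ℝ) 1 := by simp
  have h1 : (1:ℝ) ∈ Icc (0:ℝ) 1 := by simp
  have hint : ∀ x y, x ∈ Icc (0:ℝ) 1 → y ∈ Icc (0:ℝ) 1 → IntervalIntegrable a volume x y :=
    fun x y hx hy => ((uIcc_of_le (zero_le_one' ℝ)).symm ▸ ha_int).intervalIntegrable.mono_set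
      (uIcc_subset_uIcc (by simpa using hx) (by simpa using hy))
  have hAcont : ContinuousOn A (Icc 0 1) := by
    have := intervalIntegral.continuousOn_primitive_interval (f := a) (a := 0) (b := 1)
      (μ := volume) (by simpa using ha_int)
    rw [uIcc_of_le zero_le_one] at this
    exact this.congr hA
  have hA0 : A 0 = 0 := by simp [hA 0 h0]
  have hAC : ∀ t ∈ Icc (0:ℝ) 1, A t ≤ C * t := by
    intro t ht
    rw [hA t ht]
    calc ∫ s in (0:ℝ)..t, a s ≤ ∫ s in (0:ℝ)..t, C :=
          intervalIntegral.integral_mono_on ht.1 (hint 0 t h0 ht) intervalIntegrable_const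
            fun s hs => (le_abs_self _).trans (hC s ⟨hs.1, hs.2.trans ht.2⟩)
      _ = C * t := by simp [mul_comm]
  have hAhatC : ∀ t ∈ Icc (0:ℝ) 1, Ahat t ≤ C * t := by
    refine hleast _ ⟨convex_Icc 0 1, fun x _ y _ c d _ _ _ => le_of_eq ?_⟩ hAC
    simp only [smul_eq_mul]
    ring
  have hA_nonneg : ∀ t ∈ Icc (0:ℝ) 1, 0 ≤ A t := fun t ht => by
    rw [hA t ht]
    exact intervalIntegral.integral_nonneg ht.1 fun s hs => ha_nonneg s ⟨hs.1, hs.2.trans ht.2⟩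
  have hAhat0 : Ahat 0 = 0 :=
    le_antisymm (by simpa using hAhatC 0 h0) (hA0.symm.le.trans (hge 0 h0))
  have hAhat1 : Ahat 1 = A 1 := by
    refine le_antisymm (hleast (fun _ => A 1) (concaveOn_const _ (convex_Icc 0 1)) ?_ 1 h1)
      (hge 1 h1)
    intro t ht
    have := intervalIntegral.integral_add_adjacent_intervals (hint 0 t h0 ht) (hint t 1 ht h1)
    have h2 : 0 ≤ ∫ s in t..1, a s :=
      intervalIntegral.integral_nonneg ht.2 fun s hs => ha_nonneg s ⟨ht.1.trans hs.1, hs.2⟩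
    rw [hA t ht, hA 1 h1]
    linarith
  have hcont : ContinuousOn Ahat (Icc 0 1) := by
    intro t ht
    rcases ht.1.eq_or_lt with rfl | ht0
    · have hlim : Filter.Tendsto (fun s : ℝ => C * s) (nhdsWithin 0 (Icc 0 1)) (nhds 0) := by
        have : ContinuousWithinAt (fun s : ℝ => C * s) (Icc 0 1) 0 := by fun_prop
        simpa [ContinuousWithinAt] using this
      rw [ContinuousWithinAt, hAhat0]
      refine tendsto_of_tendsto_of_tendsto_of_le_of_le' tendsto_const_nhds hlim ?_ ?_
      · filter_upwards [self_mem_nhdsWithin] with s hs using (hA_nonneg s hs).trans (hge s hs)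
      · filter_upwards [self_mem_nhdsWithin] with s hs using hAhatC s hs
    rcases ht.2.eq_or_lt with rfl | ht1
    · exact (hderiv 1 ⟨one_pos, le_rfl⟩).continuousWithinAt.mono Icc_subset_Iic_self
    · exact (hconc.continuousOn_interior.continuousAt
        (isOpen_interior.mem_nhds (by simp [ht0, ht1]))).continuousWithinAt
  have hbound : ∀ t ∈ Ioc (0:ℝ) 1, ahat t ≤ C := by
    intro t ht
    have ht' : t ∈ Icc (0:ℝ) 1 := ⟨ht.1.le, ht.2⟩
    have := hconc.le_slope_of_hasDerivWithinAt_Iio h0 ht' ht.1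
      ((hderiv t ht).mono Iio_subset_Iic_self)
    rw [slope_def_field, hAhat0, sub_zero, sub_zero, le_div_iff₀ ht.1] at this
    exact le_of_mul_le_mul_right (this.trans (hAhatC t ht')) ht.1
  have hint' : IntegrableOn ahat (Ioc 0 1) := by
    refine Integrable.mono' (integrable_const C)
      (aemeasurable_restrict_of_antitoneOn measurableSet_Ioc hanti).aestronglyMeasurable ?_
    filter_upwards [ae_restrict_mem measurableSet_Ioc] with t ht
    rw [Real.norm_of_nonneg (hnonneg t ht)]
    exact hbound t ht
  have hFTC : ∀ t ∈ Icc (0:ℝ) 1, ∫ s in (0:ℝ)..t, ahat s = Ahat t := by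
    intro t ht
    rw [integral_eq_sub_of_hasDerivWithinAt_Iic ht.1
      (hcont.mono (Icc_subset_Icc le_rfl ht.2))
      (fun s hs => hderiv s ⟨hs.1, hs.2.le.trans ht.2⟩)
      ((intervalIntegrable_iff_integrableOn_Ioc_of_le ht.1).2
        (hint'.mono_set (Ioc_subset_Ioc le_rfl ht.2))), hAhat0, sub_zero]
  refine ⟨fun s hs => ha_nonneg s ⟨hs.1.le, hs.2⟩, hnonneg,
    ha_int.mono_set Ioc_subset_Icc_self, hint', hanti, fun t ht => ?_, ?_, fun τ hτ hlt => ?_⟩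
  · rw [← hA t ht, hFTC t ht]
    exact hge t ht
  · rw [← hA 1 h1, hFTC 1 h1, hAhat1]
  · have hτ' : τ ∈ Icc (0:ℝ) 1 := ⟨hτ.1.le, hτ.2.le⟩
    rw [← hA τ hτ', hFTC τ hτ'] at hlt
    exact exists_leftDeriv_eq_of_lt_concaveHull hAcont hconc hge hleast hderiv hτ hlt

namespace IsHullDensity

variable {a α : ℝ → ℝ}

lemma integrableOn_sqrt (h : IsHullDensity a α) :
    IntegrableOn (fun s => √(α s)) (Ioc 0 1) := by
  refine Integrable.mono' ((integrable_const (1:ℝ)).add h.integrable_right)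
    (Real.continuous_sqrt.measurable.comp_aemeasurable
      (h.aemeasurable_right le_rfl)).aestronglyMeasurable ?_
  filter_upwards [ae_restrict_mem measurableSet_Ioc] with s hs
  rw [Real.norm_of_nonneg (Real.sqrt_nonneg _)]
  have := h.nonneg_right s hs
  refine Real.sqrt_le_iff.2 ⟨by simp only [Pi.add_apply]; linarith, ?_⟩
  simp only [Pi.add_apply]
  nlinarith

lemma lintegral_sqrt (h : IsHullDensity a α) :
    ∫⁻ s in Ioc 0 1, ENNReal.ofReal √(α s) = ENNReal.ofReal (∫ s in Ioc 0 1, √(α s)) :=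
  (ofReal_integral_eq_lintegral_ofReal h.integrableOn_sqrt
    (Eventually.of_forall fun _ => Real.sqrt_nonneg _)).symm

lemma vfun_eq (h : IsHullDensity a α) {s : ℝ} (hs : s ∈ Ioc (0:ℝ) 1) :
    vfun a α s = √(2 * Real.log 2) * (a s * (√(α s))⁻¹) := by
  unfold vfun
  split_ifs with h0
  · rw [Real.sqrt_div' _ h0.le]
    ring
  · simp [le_antisymm (not_lt.1 h0) (h.nonneg_right s hs)]

lemma vfun_nonneg (h : IsHullDensity a α) {s : ℝ} (hs : s ∈ Ioc (0:ℝ) 1) :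
    0 ≤ vfun a α s := by
  have := h.nonneg_left s hs
  rw [h.vfun_eq hs]
  positivity

lemma aemeasurable_vfun (h : IsHullDensity a α) :
    AEMeasurable (vfun a α) (volume.restrict (Ioc 0 1)) := by
  refine AEMeasurable.congr (((h.aemeasurable_left le_rfl).mul
    (Real.continuous_sqrt.measurable.comp_aemeasurable
      (h.aemeasurable_right le_rfl)).inv).const_mul √(2 * Real.log 2)) ?_
  filter_upwards [ae_restrict_mem measurableSet_Ioc] with s hs using (h.vfun_eq hs).symm

lemma lintegral_vfun (h : IsHullDensity a α) :
    ∫⁻ s in Ioc 0 1, ENNReal.ofReal (vfun a α s) =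
      ENNReal.ofReal (√(2 * Real.log 2) * ∫ s in Ioc 0 1, √(α s)) := by
  rw [ENNReal.ofReal_mul (Real.sqrt_nonneg _), ← h.lintegral_sqrt, ← h.lintegral_mul_inv_sqrt,
    ← lintegral_const_mul' _ _ ENNReal.ofReal_ne_top]
  refine setLIntegral_congr_fun measurableSet_Ioc fun s hs => ?_
  rw [h.vfun_eq hs, ENNReal.ofReal_mul (Real.sqrt_nonneg _),
    ENNReal.ofReal_mul (h.nonneg_left s hs)]

lemma integrableOn_vfun (h : IsHullDensity a α) : IntegrableOn (vfun a α) (Ioc 0 1) := by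
  refine (lintegral_ofReal_ne_top_iff_integrable h.aemeasurable_vfun.aestronglyMeasurable ?_).1 ?_
  · filter_upwards [ae_restrict_mem measurableSet_Ioc] with s hs using h.vfun_nonneg hs
  · rw [h.lintegral_vfun]
    exact ENNReal.ofReal_ne_top

lemma integral_vfun (h : IsHullDensity a α) :
    ∫ s in (0:ℝ)..1, vfun a α s = √(2 * Real.log 2) * ∫ s in Ioc 0 1, √(α s) := by
  have h0 : 0 ≤ ∫ s in Ioc 0 1, √(α s) := integral_nonneg fun _ => Real.sqrt_nonneg _
  rw [intervalIntegral.integral_of_le zero_le_one, integral_eq_lintegral_of_nonneg_ae ?_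
    h.aemeasurable_vfun.aestronglyMeasurable, h.lintegral_vfun,
    ENNReal.toReal_ofReal (by positivity)]
  filter_upwards [ae_restrict_mem measurableSet_Ioc] with s hs using h.vfun_nonneg hs

lemma Ecost_vfun_le (h : IsHullDensity a α) {t : ℝ} (ht : t ∈ Icc (0:ℝ) 1) :
    Ecost a (vfun a α) t ≤ ENNReal.ofReal (Real.log 2 * t) := by
  have hlog : 0 ≤ Real.log 2 := Real.log_nonneg (by norm_num)
  rw [ENNReal.ofReal_mul hlog]
  refine le_trans ?_ (mul_le_mul_right (h.lintegral_mul_inv_le ht) _)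
  rw [← lintegral_const_mul' _ _ ENNReal.ofReal_ne_top, Ecost]
  refine setLIntegral_mono' measurableSet_Ioc fun s hs => ?_
  have hs1 : s ∈ Ioc (0:ℝ) 1 := ⟨hs.1, hs.2.trans ht.2⟩
  have hv := h.vfun_eq hs1
  split_ifs with ha hb
  · simp
  · exact absurd (by simp [hv, ha]) hb
  · rw [← ENNReal.ofReal_mul (h.nonneg_left s hs1), ← ENNReal.ofReal_mul hlog]
    refine ENNReal.ofReal_le_ofReal (le_of_eq ?_)
    rw [hv, mul_pow, mul_pow, inv_pow, Real.sq_sqrt (by positivity),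
      Real.sq_sqrt (h.nonneg_right s hs1)]
    field_simp

lemma integral_le_of_Ecost_le (h : IsHullDensity a α) {b : ℝ → ℝ}
    (hb : IntegrableOn b (Ioc 0 1))
    (hE : ∀ t ∈ Icc (0:ℝ) 1, Ecost a b t ≤ ENNReal.ofReal (Real.log 2 * t)) :
    ∫ s in Ioc 0 1, b s ≤ √(2 * Real.log 2) * ∫ s in Ioc 0 1, √(α s) := by
  have hlog : 0 < Real.log 2 := Real.log_pos (by norm_num)
  set c := √(2 * Real.log 2) with hc
  have hc0 : 0 < c := Real.sqrt_pos.2 (by positivity)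
  have hc2 : c ^ 2 = 2 * Real.log 2 := Real.sq_sqrt (by positivity)
  set J := ∫ s in Ioc 0 1, √(α s) with hJ
  have hJ0 : 0 ≤ J := integral_nonneg fun _ => Real.sqrt_nonneg _
  set F : ℝ → ENNReal := fun s => if a s = 0 then (if b s = 0 then 0 else ⊤)
    else ENNReal.ofReal (b s ^ 2 / (2 * a s)) with hF
  have hFeq : ∀ s ∈ Ioc (0:ℝ) 1,
      ENNReal.ofReal (b s ^ 2) / ENNReal.ofReal (2 * a s) = F s := by
    intro s hs
    simp only [hF]
    split_ifs with h1 h2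
    · simp [h1, h2]
    · rw [h1, mul_zero, ENNReal.ofReal_zero]
      exact ENNReal.div_zero (by simp; positivity)
    · have := (h.nonneg_left s hs).lt_of_ne' h1
      rw [ENNReal.ofReal_div_of_pos (by positivity)]
  have hFm : AEMeasurable F (volume.restrict (Ioc 0 1)) := by
    refine AEMeasurable.congr ((hb.aemeasurable.pow_const 2).ennreal_ofReal.div
      ((h.aemeasurable_left le_rfl).const_mul 2).ennreal_ofReal) ?_
    filter_upwards [ae_restrict_mem measurableSet_Ioc] with s hs using hFeq s hs
  have hFtop : ∀ᵐ s ∂volume.restrict (Ioc (0:ℝ) 1), F s < ⊤ :=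
    ae_lt_top' hFm ((hE 1 (by simp)).trans_lt ENNReal.ofReal_lt_top).ne
  have hweight : ∫⁻ s in Ioc 0 1, F s * ENNReal.ofReal √(α s) ≤
      ENNReal.ofReal (Real.log 2 * J) := by
    refine (lintegral_mul_ofReal_le_of_antitoneOn hFm
      (g := fun _ => ENNReal.ofReal (Real.log 2)) aemeasurable_const (fun t ht => ?_)
      (fun s hs r hr hsr => Real.sqrt_le_sqrt (h.antitone hs hr hsr))
      fun s => Real.sqrt_nonneg _).trans_eq ?_
    · refine (hE t ht).trans_eq ?_
      simp [ENNReal.ofReal_mul hlog.le]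
    · rw [lintegral_const_mul' _ _ ENNReal.ofReal_ne_top, h.lintegral_sqrt,
        ENNReal.ofReal_mul hlog.le]
  have hpt : ∀ᵐ s ∂volume.restrict (Ioc (0:ℝ) 1), ENNReal.ofReal (b s) ≤
      ENNReal.ofReal c⁻¹ * (F s * ENNReal.ofReal √(α s)) +
        ENNReal.ofReal (1 / 2) * ENNReal.ofReal (vfun a α s) := by
    filter_upwards [ae_restrict_mem measurableSet_Ioc, hFtop, h.ae_pos_of_pos] with s hs hFs hpos
    rcases (h.nonneg_left s hs).eq_or_lt' with ha | ha
    · have hb0 : b s = 0 := by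
        by_contra hb0
        simp [hF, ha, hb0] at hFs
      simp [hb0]
    · have hr : 0 < √(α s) := Real.sqrt_pos.2 (hpos ha)
      have hv := h.vfun_nonneg hs
      simp only [hF, if_neg ha.ne']
      rw [← ENNReal.ofReal_mul (by positivity), ← ENNReal.ofReal_mul (by positivity),
        ← ENNReal.ofReal_mul (by positivity), ← ENNReal.ofReal_add (by positivity) (by positivity)]
      refine ENNReal.ofReal_le_ofReal ?_
      rw [h.vfun_eq hs, ← hc]
      have hsq : c⁻¹ * (b s ^ 2 / (2 * a s) * √(α s)) + 1 / 2 * (c * (a s * (√(α s))⁻¹)) - b s =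
          √(α s) / (2 * c * a s) * (b s - c * (a s * (√(α s))⁻¹)) ^ 2 := by
        field_simp
        ring
      have : 0 ≤ √(α s) / (2 * c * a s) * (b s - c * (a s * (√(α s))⁻¹)) ^ 2 := by positivity
      linarith
  have hle : ∫⁻ s in Ioc 0 1, ENNReal.ofReal (b s) ≤ ENNReal.ofReal (c * J) := by
    refine (lintegral_mono_ae hpt).trans ?_
    rw [lintegral_add_right' _ (h.aemeasurable_vfun.ennreal_ofReal.const_mul _),
      lintegral_const_mul' _ _ ENNReal.ofReal_ne_top,
      lintegral_const_mul' _ _ ENNReal.ofReal_ne_top, h.lintegral_vfun]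
    refine (add_le_add_left (mul_le_mul_right hweight _) _).trans_eq ?_
    rw [← hc, ← hJ, ← ENNReal.ofReal_mul (by positivity), ← ENNReal.ofReal_mul (by positivity),
      ← ENNReal.ofReal_add (by positivity) (by positivity)]
    congr 1
    field_simp
    linear_combination (-J) * hc2
  rw [integral_eq_lintegral_pos_part_sub_lintegral_neg_part hb]
  refine (sub_le_self _ ENNReal.toReal_nonneg).trans ?_
  exact ENNReal.toReal_le_of_le_ofReal (by positivity) hle

end IsHullDensity

theorem stmt15 (a A Ahat ahat : ℝ → ℝ)
    (ha_nonneg : ∀ s ∈ Set.Icc (0:ℝ) 1, 0 ≤ a s)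
    (ha_int : RiemannIntegrableOn01 a)
    (hA : ∀ t ∈ Set.Icc (0:ℝ) 1, A t = ∫ s in (0:ℝ)..t, a s)
    (hA1 : A 1 = 1)
    (hAhat_conc : ConcaveOn ℝ (Set.Icc 0 1) Ahat)
    (hAhat_ge : ∀ t ∈ Set.Icc (0:ℝ) 1, A t ≤ Ahat t)
    (hAhat_least : ∀ g : ℝ → ℝ, ConcaveOn ℝ (Set.Icc 0 1) g →
      (∀ t ∈ Set.Icc (0:ℝ) 1, A t ≤ g t) → ∀ t ∈ Set.Icc (0:ℝ) 1, Ahat t ≤ g t)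
    (hahat_deriv : ∀ t ∈ Set.Ioc (0:ℝ) 1, HasDerivWithinAt Ahat (ahat t) (Set.Iic t) t)
    (hahat_nonneg : ∀ t ∈ Set.Ioc (0:ℝ) 1, 0 ≤ ahat t)
    (hahat_anti : AntitoneOn ahat (Set.Ioc 0 1)) :
    -- the function `z t = ∫₀ᵗ v s ds` belongs to `Z`,
    memZ a (fun t => ∫ s in (0:ℝ)..t, vfun a ahat s) ∧
    -- it attains the value `√(2 log 2)·∫₀¹ √(ahat t) dt` at `t = 1`,
    (∫ s in (0:ℝ)..1, vfun a ahat s) =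
      Real.sqrt (2 * Real.log 2) * ∫ t in Set.Ioc (0:ℝ) 1, Real.sqrt (ahat t) ∧
    -- and no element of `Z` does better: the sup of `z 1` over `Z` equals this value.
    ∀ z : ℝ → ℝ, memZ a z →
      z 1 ≤ Real.sqrt (2 * Real.log 2) * ∫ t in Set.Ioc (0:ℝ) 1, Real.sqrt (ahat t) := by
  obtain ⟨ha_int, -, C, hC⟩ := ha_int
  have h := isHullDensity_of_concaveHull ha_nonneg ha_int hC hA hAhat_conc hAhat_ge hAhat_least
    hahat_deriv hahat_nonneg hahat_anti
  refine ⟨⟨vfun a ahat, (integrableOn_Icc_iff_integrableOn_Ioc).2 h.integrableOn_vfun,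
    fun _ _ => rfl, fun t ht => h.Ecost_vfun_le ht⟩, h.integral_vfun, ?_⟩
  rintro z ⟨b, hb, hz, hE⟩
  rw [hz 1 (by simp), intervalIntegral.integral_of_le zero_le_one]
  exact h.integral_le_of_Ecost_le (hb.mono_set Ioc_subset_Icc_self) hE
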